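/- Soundness of sequential merging: if the sequential merging (r₁ ;_p r₂) : G → G' is a rewrite, then there exist a graph H and matches e₁, e₂ such that G rewrites to H by the extension of r₁ at e₁, and H rewrites to G' by the extension of r₂ at e₂. -/

import Mathlib

open CategoryTheory

/-- A pre-open graph: a set of edges, vertices and edge-points, with source and
target maps into the disjoint union of vertices and edge-points. -/
structure POG : Type 1 where
  E : Type
  V : Type
  Eps : Type
  s : E → V ⊕ Eps
  t : E → V ⊕ Eps

namespace POG

/-- A pre-open graph is an open graph when every edge-point is the source of at
most one edge and the target of at most one edge. -/
def IsOpen (G : POG) : Prop :=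
  (∀ e e' p, G.s e = Sum.inr p → G.s e' = Sum.inr p → e = e') ∧
  (∀ e e' p, G.t e = Sum.inr p → G.t e' = Sum.inr p → e = e')

def IsFinite (G : POG) : Prop := Finite G.E ∧ Finite G.V ∧ Finite G.Eps

/-- The edge-point `p` has an in-edge. -/
def HasIn (G : POG) (p : G.Eps) : Prop := ∃ e, G.t e = Sum.inr p

/-- The edge-point `p` has an out-edge. -/
def HasOut (G : POG) (p : G.Eps) : Prop := ∃ e, G.s e = Sum.inr p

/-- An input: an edge-point with an out-edge and no in-edge. -/
def IsInput (G : POG) (p : G.Eps) : Prop := G.HasOut p ∧ ¬ G.HasIn p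

/-- An output: an edge-point with an in-edge and no out-edge. -/
def IsOutput (G : POG) (p : G.Eps) : Prop := G.HasIn p ∧ ¬ G.HasOut p

/-- A boundary point is an input or an output. -/
def IsBoundaryPt (G : POG) (p : G.Eps) : Prop := G.IsInput p ∨ G.IsOutput p

/-- An isolated point: no in-edges and no out-edges. -/
def IsIsolated (G : POG) (p : G.Eps) : Prop := ¬ G.HasIn p ∧ ¬ G.HasOut p

/-- A point graph consists solely of (isolated) edge-points: no edges, no vertices. -/
def IsPointGraph (G : POG) : Prop := IsEmpty G.E ∧ IsEmpty G.V

def Inputs (G : POG) : Type := {p : G.Eps // G.IsInput p}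

def Outputs (G : POG) : Type := {p : G.Eps // G.IsOutput p}

/-- Two graphs have the same boundary when their interfaces are isomorphic,
i.e. there are bijections between their inputs and between their outputs. -/
def SameBoundary (G H : POG) : Prop :=
  Nonempty (G.Inputs ≃ H.Inputs) ∧ Nonempty (G.Outputs ≃ H.Outputs)

/-- The tensor product (disjoint union) of two graphs: the merging along the
empty graph. -/
def tensor (G H : POG) : POG where
  E := G.E ⊕ H.E
  V := G.V ⊕ H.V
  Eps := G.Eps ⊕ H.Eps
  s := fun e => match e with
    | Sum.inl e => Sum.map Sum.inl Sum.inl (G.s e)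
    | Sum.inr e => Sum.map Sum.inr Sum.inr (H.s e)
  t := fun e => match e with
    | Sum.inl e => Sum.map Sum.inl Sum.inl (G.t e)
    | Sum.inr e => Sum.map Sum.inr Sum.inr (H.t e)

/-- The one-step contraction of an open graph `G` at an interior edge-point `p`
with (unique) in-edge `e₁` and (unique) out-edge `e₂`: the edges `e₁, e₂` and
the point `p` are replaced by a single fresh edge from the source of `e₁` to
the target of `e₂`. -/
def contract (G : POG) (hG : G.IsOpen) (p : G.Eps) (e₁ e₂ : G.E)
    (h1 : G.t e₁ = Sum.inr p) (h2 : G.s e₂ = Sum.inr p) (hne : e₁ ≠ e₂) : POG where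
  E := {e : G.E // e ≠ e₁ ∧ e ≠ e₂} ⊕ PUnit
  V := G.V
  Eps := {q : G.Eps // q ≠ p}
  s := fun x => match x with
    | Sum.inl ⟨e, he⟩ =>
        match h : G.s e with
        | Sum.inl v => Sum.inl v
        | Sum.inr q => Sum.inr ⟨q, fun hq => he.2 (hG.1 e e₂ p (hq ▸ h) h2)⟩
    | Sum.inr _ =>
        match h : G.s e₁ with
        | Sum.inl v => Sum.inl v
        | Sum.inr q => Sum.inr ⟨q, fun hq => hne (hG.1 e₁ e₂ p (hq ▸ h) h2)⟩
  t := fun x => match x with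
    | Sum.inl ⟨e, he⟩ =>
        match h : G.t e with
        | Sum.inl v => Sum.inl v
        | Sum.inr q => Sum.inr ⟨q, fun hq => he.1 (hG.2 e e₁ p (hq ▸ h) h1)⟩
    | Sum.inr _ =>
        match h : G.t e₂ with
        | Sum.inl v => Sum.inl v
        | Sum.inr q => Sum.inr ⟨q, fun hq => hne ((hG.2 e₂ e₁ p (hq ▸ h) h1).symm)⟩

end POG

/-- A homomorphism of pre-open graphs: maps on edges, vertices and edge-points
commuting with source and target. -/
structure POGHom (G H : POG) : Type where
  edgeMap : G.E → H.E
  vMap : G.V → H.V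
  epMap : G.Eps → H.Eps
  s_comm : ∀ e, H.s (edgeMap e) = Sum.map vMap epMap (G.s e)
  t_comm : ∀ e, H.t (edgeMap e) = Sum.map vMap epMap (G.t e)

namespace POGHom

def id (G : POG) : POGHom G G where
  edgeMap := fun e => e
  vMap := fun v => v
  epMap := fun q => q
  s_comm := fun e => by cases h : G.s e <;> simp [h]
  t_comm := fun e => by cases h : G.t e <;> simp [h]

def comp {G H K : POG} (g : POGHom H K) (f : POGHom G H) : POGHom G K where
  edgeMap := fun e => g.edgeMap (f.edgeMap e)
  vMap := fun v => g.vMap (f.vMap v)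
  epMap := fun q => g.epMap (f.epMap q)
  s_comm := fun e => by rw [g.s_comm, f.s_comm]; cases G.s e <;> rfl
  t_comm := fun e => by rw [g.t_comm, f.t_comm]; cases G.t e <;> rfl

/-- The homomorphism is injective (a monomorphism). -/
def Inj {G H : POG} (f : POGHom G H) : Prop :=
  Function.Injective f.edgeMap ∧ Function.Injective f.vMap ∧ Function.Injective f.epMap

/-- The homomorphism is full on vertices: every edge of the codomain incident to
the image of a vertex is itself in the image. -/
def FullOnVertices {G H : POG} (f : POGHom G H) : Prop :=
  ∀ (v : G.V) (e : H.E),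
    (H.s e = Sum.inl (f.vMap v) ∨ H.t e = Sum.inl (f.vMap v)) → ∃ e₀, f.edgeMap e₀ = e

/-- An open embedding: an injective homomorphism which is full on vertices. -/
def IsEmbedding {G H : POG} (f : POGHom G H) : Prop := f.Inj ∧ f.FullOnVertices

/-- An isomorphism of pre-open graphs. -/
def IsIso {G H : POG} (f : POGHom G H) : Prop :=
  Function.Bijective f.edgeMap ∧ Function.Bijective f.vMap ∧ Function.Bijective f.epMap

end POGHom

/-- `G` and `H` are isomorphic pre-open graphs. -/
def Isomorphic (G H : POG) : Prop := ∃ f : POGHom G H, f.IsIso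

/-- A pair of homomorphisms with common domain is boundary-coherent. -/
def BoundaryCoherent {K G₁ G₂ : POG} (f : POGHom K G₁) (g : POGHom K G₂) : Prop :=
  (∀ p : K.Eps, K.IsBoundaryPt p →
      ¬ G₁.IsBoundaryPt (f.epMap p) → G₂.IsBoundaryPt (g.epMap p)) ∧
  (∀ p : K.Eps, K.IsIsolated p →
      G₁.IsIsolated (f.epMap p) ∨ G₂.IsIsolated (g.epMap p) ∨
      ((G₁.IsInput (f.epMap p) ↔ G₂.IsOutput (g.epMap p)) ∧
       (G₁.IsOutput (f.epMap p) ↔ G₂.IsInput (g.epMap p))))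

/-- `M` together with `i₁, i₂` is the pushout of `e₁, e₂` in the category of
open graphs. -/
def IsPushout {K G₁ G₂ M : POG} (e₁ : POGHom K G₁) (e₂ : POGHom K G₂)
    (i₁ : POGHom G₁ M) (i₂ : POGHom G₂ M) : Prop :=
  M.IsOpen ∧ i₁.comp e₁ = i₂.comp e₂ ∧
  ∀ (N : POG), N.IsOpen → ∀ (j₁ : POGHom G₁ N) (j₂ : POGHom G₂ N),
    j₁.comp e₁ = j₂.comp e₂ → ∃! u : POGHom M N, u.comp i₁ = j₁ ∧ u.comp i₂ = j₂

/-- A merging: the pushout in OGraph of a boundary-coherent pair of open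
embeddings. -/
def IsMergingAt {K G₁ G₂ M : POG} (e₁ : POGHom K G₁) (e₂ : POGHom K G₂)
    (i₁ : POGHom G₁ M) (i₂ : POGHom G₂ M) : Prop :=
  K.IsOpen ∧ G₁.IsOpen ∧ G₂.IsOpen ∧
  e₁.IsEmbedding ∧ e₂.IsEmbedding ∧ BoundaryCoherent e₁ e₂ ∧ IsPushout e₁ e₂ i₁ i₂

/-- A plugging: a merging whose shared graph is a point graph embedded by
boundary embeddings. -/
def IsPluggingAt {K G₁ G₂ M : POG} (e₁ : POGHom K G₁) (e₂ : POGHom K G₂)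
    (i₁ : POGHom G₁ M) (i₂ : POGHom G₂ M) : Prop :=
  IsMergingAt e₁ e₂ i₁ i₂ ∧ K.IsPointGraph ∧
  (∀ q : K.Eps, G₁.IsBoundaryPt (e₁.epMap q)) ∧
  (∀ q : K.Eps, G₂.IsBoundaryPt (e₂.epMap q))

/-- One contraction step, up to isomorphism: `H` is (isomorphic to) the result
of contracting away an interior edge-point of `G`. -/
def StepContract (G H : POG) : Prop :=
  ∃ (hG : G.IsOpen) (p : G.Eps) (e₁ e₂ : G.E) (h1 : G.t e₁ = Sum.inr p)
    (h2 : G.s e₂ = Sum.inr p) (hne : e₁ ≠ e₂),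
    Isomorphic (G.contract hG p e₁ e₂ h1 h2 hne) H

/-- `H ≼ G`: `G` contracts to `H` (in any number of steps, up to isomorphism). -/
def ContractsTo (G H : POG) : Prop :=
  Isomorphic G H ∨ Relation.TransGen StepContract G H

/-- `G ∼ H`: homeomorphism, the symmetric closure of the contraction order. -/
def Homeo (G H : POG) : Prop := ContractsTo G H ∨ ContractsTo H G

/-- A proper (minimal) open graph: minimal with respect to `≼`. -/
def POG.IsProper (G : POG) : Prop :=
  G.IsOpen ∧ ∀ H : POG, ContractsTo G H → Isomorphic G H

/-- `L` matches `G`: there is some `G' ∼ G` and an open embedding of `L` into `G'`. -/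
def Matches (L G : POG) : Prop :=
  ∃ G' : POG, Homeo G' G ∧ ∃ e : POGHom L G', e.IsEmbedding

/-- Transport of a homomorphism out of an edgeless graph along a contraction. -/
def contractTransport {K G : POG} (hKE : IsEmpty K.E) (f : POGHom K G)
    (hG : G.IsOpen) (p : G.Eps) (e₁ e₂ : G.E) (h1 : G.t e₁ = Sum.inr p)
    (h2 : G.s e₂ = Sum.inr p) (hne : e₁ ≠ e₂) (hp : ∀ q, f.epMap q ≠ p) :
    POGHom K (G.contract hG p e₁ e₂ h1 h2 hne) where
  edgeMap := fun e => (hKE.false e).elim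
  vMap := f.vMap
  epMap := fun q => ⟨f.epMap q, hp q⟩
  s_comm := fun e => (hKE.false e).elim
  t_comm := fun e => (hKE.false e).elim

/-- A graph equipped with a homomorphism from a fixed (point) graph `K`. -/
def PointedGraph (K : POG) : Type 1 := Σ G : POG, POGHom K G

/-- One contraction step of a `K`-pointed graph, transporting the distinguished
map along the contraction. -/
def StepContractRel (K : POG) (hKE : IsEmpty K.E) (x y : PointedGraph K) : Prop :=
  ∃ (hG : x.1.IsOpen) (p : x.1.Eps) (e₁ e₂ : x.1.E) (h1 : x.1.t e₁ = Sum.inr p)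
    (h2 : x.1.s e₂ = Sum.inr p) (hne : e₁ ≠ e₂) (hp : ∀ q, x.2.epMap q ≠ p),
    ∃ φ : POGHom (x.1.contract hG p e₁ e₂ h1 h2 hne) y.1,
      φ.IsIso ∧ φ.comp (contractTransport hKE x.2 hG p e₁ e₂ h1 h2 hne hp) = y.2

/-- Isomorphism of `K`-pointed graphs. -/
def IsoRel (K : POG) (x y : PointedGraph K) : Prop :=
  ∃ φ : POGHom x.1 y.1, φ.IsIso ∧ φ.comp x.2 = y.2

/-- Contraction order on `K`-pointed graphs, up to isomorphism. -/
def ContractsToRel (K : POG) (hKE : IsEmpty K.E) (x y : PointedGraph K) : Prop :=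
  IsoRel K x y ∨ Relation.TransGen (StepContractRel K hKE) x y

/-- Homeomorphism of `K`-pointed graphs: `y.1 ∼ x.1`, with the distinguished map
`x.2` "considered as a map into" `y.1` being `y.2`. -/
def HomeoRel (K : POG) (hKE : IsEmpty K.E) (x y : PointedGraph K) : Prop :=
  ContractsToRel K hKE x y ∨ ContractsToRel K hKE y x

/-- A rewrite rule: a pair of open graphs with the same boundary. -/
def IsRewrite (L R : POG) : Prop := L.IsOpen ∧ R.IsOpen ∧ POG.SameBoundary L R

/-- Two pluggings (of the same point graph `P` into the two sides `L`, `R` of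
rewrite rules) correspond: along the identification of the boundaries,
corresponding plugged points have the same input/output status. -/
def PlugCorresponds {P L R : POG} (b : POGHom P L) (c : POGHom P R) : Prop :=
  ∀ q : P.Eps, (L.IsInput (b.epMap q) ↔ R.IsInput (c.epMap q)) ∧
               (L.IsOutput (b.epMap q) ↔ R.IsOutput (c.epMap q))

/-- `M' = M[G ↦ G']ₑ`: substitution of `G'` for `G` in `M` at `e : G → M`,
defined by the pair of pushouts that first compute the subtraction `D = M −ₑ G`
(so that `M` is the plugging of `G` with `D` along the interface point graph
`P`) and then plug `G'` onto `D` along the same interface. -/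
def IsSubstitutionAt (M : POG) {G : POG} (e : POGHom G M) (G' M' : POG) : Prop :=
  ∃ (D P : POG) (b : POGHom P G) (d : POGHom P D) (b' : POGHom P G')
    (iD : POGHom D M) (iG' : POGHom G' M') (iD' : POGHom D M'),
    IsPluggingAt b d e iD ∧ IsPluggingAt b' d iG' iD'

/-- `G` rewrites to `H` by (an extension of) the rule `L → R`:
there are `G'' ∼ G` and a matching `e : L → G''` with `H = G''[L ↦ R]ₑ`. -/
def RewriteStep (L R G H : POG) : Prop :=
  ∃ G'' : POG, Homeo G'' G ∧
    ∃ e : POGHom L G'', e.IsEmbedding ∧ IsSubstitutionAt G'' e R H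

/-- The category of open graphs. -/
abbrev OGraphCat : Type 1 := {G : POG // G.IsOpen}

instance : Category OGraphCat where
  Hom X Y := POGHom X.val Y.val
  id X := POGHom.id X.val
  comp f g := g.comp f
  id_comp := fun _ => rfl
  comp_id := fun _ => rfl
  assoc := fun _ _ _ => rfl

/-- The vertices of the quiver underlying a graphical theory: the generating
set `S` of graphs. -/
abbrev RWQuiver (S : Set POG) (_R : Set (POG × POG)) : Type 1 := {G : POG // G ∈ S}

instance (S : Set POG) (R : Set (POG × POG)) : Quiver (RWQuiver S R) :=
  ⟨fun X Y => PLift ((X.val, Y.val) ∈ R)⟩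

/-- The graphical theory on generators `S` and rewrite rules `R`: the category
whose objects are the graphs in `S` and whose arrows are formal sequential
compositions (paths) of rewrites in `R`. -/
def GThy (S : Set POG) (R : Set (POG × POG)) : Type 1 := Paths (RWQuiver S R)

instance (S : Set POG) (R : Set (POG × POG)) : Category (GThy S R) :=
  inferInstanceAs (Category (Paths (RWQuiver S R)))

def toGThy {S : Set POG} {R : Set (POG × POG)} (X : RWQuiver S R) : GThy S R := X

/-- The tensor product on objects of a graphical theory. -/
def tensorMk {S : Set POG} {R : Set (POG × POG)}
    (hS : ∀ G ∈ S, ∀ H ∈ S, POG.tensor G H ∈ S) (X Y : RWQuiver S R) :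
    RWQuiver S R :=
  ⟨POG.tensor X.val Y.val, hS _ X.property _ Y.property⟩

/-- The identity exhibits every graph as homeomorphic to itself. -/
theorem Homeo.refl (G : POG) : Homeo G G :=
  Or.inl (Or.inl ⟨POGHom.id G, Function.bijective_id, Function.bijective_id,
    Function.bijective_id⟩)

theorem POGHom.ext_maps {G H : POG} {f g : POGHom G H} (hE : ∀ x, f.edgeMap x = g.edgeMap x)
    (hV : ∀ x, f.vMap x = g.vMap x) (hP : ∀ x, f.epMap x = g.epMap x) : f = g := by
  cases f
  cases g
  obtain rfl := funext hE
  obtain rfl := funext hV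
  obtain rfl := funext hP
  rfl

open Classical in
/-- The map of the edge-points of `G₂` to those of the graph obtained by gluing `G₁` and
`G₂` along `b` and `d`. -/
noncomputable def gluePt {K G₁ G₂ : POG} (b : POGHom K G₁) (d : POGHom K G₂) (q : G₂.Eps) :
    G₁.Eps ⊕ {q : G₂.Eps // ¬ ∃ k, d.epMap k = q} :=
  if h : ∃ k, d.epMap k = q then Sum.inl (b.epMap h.choose) else Sum.inr ⟨q, h⟩

theorem gluePt_apply {K G₁ G₂ : POG} (b : POGHom K G₁) {d : POGHom K G₂}
    (hd : Function.Injective d.epMap) (k : K.Eps) :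
    gluePt b d (d.epMap k) = Sum.inl (b.epMap k) := by
  have h : ∃ k', d.epMap k' = d.epMap k := ⟨k, rfl⟩
  rw [gluePt, dif_pos h, hd h.choose_spec]

theorem exists_of_gluePt_eq_inl {K G₁ G₂ : POG} {b : POGHom K G₁} {d : POGHom K G₂}
    {q : G₂.Eps} {p : G₁.Eps} (h : gluePt b d q = Sum.inl p) :
    ∃ k, d.epMap k = q ∧ b.epMap k = p := by
  unfold gluePt at h
  split at h
  · next hq => exact ⟨hq.choose, hq.choose_spec, Sum.inl.inj h⟩
  · cases h

theorem gluePt_injective {K G₁ G₂ : POG} {b : POGHom K G₁} {d : POGHom K G₂}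
    (hb : Function.Injective b.epMap) : Function.Injective (gluePt b d) := by
  intro q q' h
  cases hq : gluePt b d q with
  | inl p =>
    obtain ⟨k, rfl, hk⟩ := exists_of_gluePt_eq_inl hq
    obtain ⟨k', rfl, hk'⟩ := exists_of_gluePt_eq_inl (h.symm.trans hq)
    rw [hb (hk.trans hk'.symm)]
  | inr r =>
    rw [hq] at h
    unfold gluePt at hq h
    split at hq
    · cases hq
    · split at h
      · cases h
      · exact congrArg Subtype.val ((Sum.inr.inj hq).trans (Sum.inr.inj h))

/-- The graph obtained by gluing `G₁` and `G₂` along the edge-points of `K`. -/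
noncomputable def glue {K G₁ G₂ : POG} (b : POGHom K G₁) (d : POGHom K G₂) : POG where
  E := G₁.E ⊕ G₂.E
  V := G₁.V ⊕ G₂.V
  Eps := G₁.Eps ⊕ {q : G₂.Eps // ¬ ∃ k, d.epMap k = q}
  s := Sum.elim (fun x => Sum.map Sum.inl Sum.inl (G₁.s x))
    (fun x => Sum.map Sum.inr (gluePt b d) (G₂.s x))
  t := Sum.elim (fun x => Sum.map Sum.inl Sum.inl (G₁.t x))
    (fun x => Sum.map Sum.inr (gluePt b d) (G₂.t x))

def glueLeft {K G₁ G₂ : POG} (b : POGHom K G₁) (d : POGHom K G₂) : POGHom G₁ (glue b d) where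
  edgeMap := Sum.inl
  vMap := Sum.inl
  epMap := Sum.inl
  s_comm _ := rfl
  t_comm _ := rfl

noncomputable def glueRight {K G₁ G₂ : POG} (b : POGHom K G₁) (d : POGHom K G₂) :
    POGHom G₂ (glue b d) where
  edgeMap := Sum.inr
  vMap := Sum.inr
  epMap := gluePt b d
  s_comm _ := rfl
  t_comm _ := rfl

theorem sumMap_eq_inr_iff {A B C D : Type} {f : A → C} {g : B → D} {x : A ⊕ B} {p : D} :
    Sum.map f g x = Sum.inr p ↔ ∃ q, x = Sum.inr q ∧ g q = p := by
  cases x <;> simp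

/-- The common form of both halves of openness of a glued graph, for an incidence map
`σ₁`, `σ₂` on each side such that no two edges from different sides meet. -/
theorem glue_incidence_unique {E₁ V₁ P₁ E₂ V₂ P₂ P : Type} {σ₁ : E₁ → V₁ ⊕ P₁}
    {σ₂ : E₂ → V₂ ⊕ P₂} {f : P₁ → P} {g : P₂ → P} (hf : Function.Injective f)
    (hg : Function.Injective g)
    (h₁ : ∀ x y p, σ₁ x = Sum.inr p → σ₁ y = Sum.inr p → x = y)
    (h₂ : ∀ x y p, σ₂ x = Sum.inr p → σ₂ y = Sum.inr p → x = y)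
    (hdisj : ∀ x y p q, σ₁ x = Sum.inr p → σ₂ y = Sum.inr q → f p ≠ g q)
    (x y : E₁ ⊕ E₂) (p : P)
    (hx : Sum.elim (fun x => Sum.map (Sum.inl : V₁ → V₁ ⊕ V₂) f (σ₁ x))
      (fun x => Sum.map Sum.inr g (σ₂ x)) x = Sum.inr p)
    (hy : Sum.elim (fun x => Sum.map (Sum.inl : V₁ → V₁ ⊕ V₂) f (σ₁ x))
      (fun x => Sum.map Sum.inr g (σ₂ x)) y = Sum.inr p) : x = y := by
  rcases x with x | x <;> rcases y with y | y <;>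
    simp only [Sum.elim_inl, Sum.elim_inr, sumMap_eq_inr_iff] at hx hy <;>
    obtain ⟨q, hq, rfl⟩ := hx <;> obtain ⟨q', hq', hqq⟩ := hy
  · rw [hf hqq] at hq'
    rw [h₁ x y q hq hq']
  · exact (hdisj x y q q' hq hq' hqq.symm).elim
  · exact (hdisj y x q' q hq' hq hqq).elim
  · rw [hg hqq] at hq'
    rw [h₂ x y q hq hq']

/-- In a plugging, the two sides of a plugged point never both have an in-edge, nor both an
out-edge. -/
theorem IsPluggingAt.opposite {K G₁ G₂ M : POG} {b : POGHom K G₁} {d : POGHom K G₂}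
    {i : POGHom G₁ M} {j : POGHom G₂ M} (h : IsPluggingAt b d i j) (k : K.Eps) :
    ¬ (G₁.HasOut (b.epMap k) ∧ G₂.HasOut (d.epMap k)) ∧
      ¬ (G₁.HasIn (b.epMap k) ∧ G₂.HasIn (d.epMap k)) := by
  obtain ⟨⟨-, -, -, -, -, ⟨-, hiso⟩, -⟩, ⟨hKE, -⟩, hb, hd⟩ := h
  have h₁ := hiso k ⟨fun ⟨x, _⟩ => hKE.false x, fun ⟨x, _⟩ => hKE.false x⟩
  have h₂ := hb k
  have h₃ := hd k
  simp only [POG.IsBoundaryPt, POG.IsInput, POG.IsOutput, POG.IsIsolated] at h₁ h₂ h₃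
  tauto

theorem IsPluggingAt.glue_isOpen {K G₁ G₂ M : POG} {b : POGHom K G₁} {d : POGHom K G₂}
    {i : POGHom G₁ M} {j : POGHom G₂ M} (h : IsPluggingAt b d i j) : (glue b d).IsOpen := by
  have hopp := h.opposite
  obtain ⟨⟨-, hG₁, hG₂, hbe, -, -, -⟩, -⟩ := h
  refine ⟨glue_incidence_unique Sum.inl_injective (gluePt_injective hbe.1.2.2) hG₁.1 hG₂.1 ?_,
    glue_incidence_unique Sum.inl_injective (gluePt_injective hbe.1.2.2) hG₁.2 hG₂.2 ?_⟩ <;>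
  · intro x y p q hx hy hpq
    obtain ⟨k, rfl, rfl⟩ := exists_of_gluePt_eq_inl hpq.symm
    first
      | exact (hopp k).1 ⟨⟨x, hx⟩, ⟨y, hy⟩⟩
      | exact (hopp k).2 ⟨⟨x, hx⟩, ⟨y, hy⟩⟩

theorem comp_glueLeft_eq_comp_glueRight {K G₁ G₂ : POG} (hK : K.IsPointGraph)
    (b : POGHom K G₁) {d : POGHom K G₂} (hd : Function.Injective d.epMap) :
    (glueLeft b d).comp b = (glueRight b d).comp d :=
  POGHom.ext_maps (fun x => (hK.1.false x).elim) (fun x => (hK.2.false x).elim)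
    fun k => (gluePt_apply b hd k).symm

theorem elim_gluePt {K G₁ G₂ M : POG} {b : POGHom K G₁} {d : POGHom K G₂}
    {i : POGHom G₁ M} {j : POGHom G₂ M} (hij : i.comp b = j.comp d) (q : G₂.Eps) :
    Sum.elim i.epMap (fun r => j.epMap r.1) (gluePt b d q) = j.epMap q := by
  unfold gluePt
  split
  · next hq =>
    have h := congrFun (congrArg POGHom.epMap hij) hq.choose
    simp only [POGHom.comp, hq.choose_spec] at h
    exact h
  · rfl

/-- The map out of a glued graph induced by a cocone. -/
noncomputable def glueDesc {K G₁ G₂ M : POG} {b : POGHom K G₁} {d : POGHom K G₂}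
    {i : POGHom G₁ M} {j : POGHom G₂ M} (hij : i.comp b = j.comp d) : POGHom (glue b d) M where
  edgeMap := Sum.elim i.edgeMap j.edgeMap
  vMap := Sum.elim i.vMap j.vMap
  epMap := Sum.elim i.epMap (fun r => j.epMap r.1)
  s_comm := by
    rintro (x | x)
    · change M.s (i.edgeMap x) = Sum.map _ _ (Sum.map Sum.inl Sum.inl (G₁.s x))
      rw [i.s_comm]
      cases G₁.s x <;> rfl
    · change M.s (j.edgeMap x) = Sum.map _ _ (Sum.map Sum.inr (gluePt b d) (G₂.s x))
      rw [j.s_comm]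
      cases G₂.s x with
      | inl v => rfl
      | inr q => exact congrArg Sum.inr (elim_gluePt hij q).symm
  t_comm := by
    rintro (x | x)
    · change M.t (i.edgeMap x) = Sum.map _ _ (Sum.map Sum.inl Sum.inl (G₁.t x))
      rw [i.t_comm]
      cases G₁.t x <;> rfl
    · change M.t (j.edgeMap x) = Sum.map _ _ (Sum.map Sum.inr (gluePt b d) (G₂.t x))
      rw [j.t_comm]
      cases G₂.t x with
      | inl v => rfl
      | inr q => exact congrArg Sum.inr (elim_gluePt hij q).symm

theorem glueLeft_isEmbedding {K G₁ G₂ : POG} (b : POGHom K G₁) (d : POGHom K G₂) :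
    (glueLeft b d).IsEmbedding := by
  refine ⟨⟨Sum.inl_injective, Sum.inl_injective, Sum.inl_injective⟩, ?_⟩
  rintro v (x | x) hx
  · exact ⟨x, rfl⟩
  · simp only [glue, glueLeft, Sum.elim_inr] at hx
    rcases hx with hx | hx
    · cases h : G₂.s x <;> simp [h] at hx
    · cases h : G₂.t x <;> simp [h] at hx

/-- If `u ∘ i` is an open embedding and `u` has a retraction `w`, then `i` is an open
embedding. -/
theorem POGHom.IsEmbedding.of_comp {G M N : POG} {i : POGHom G M} {u : POGHom M N}
    {w : POGHom N M} (hw : w.comp u = POGHom.id M) (h : (u.comp i).IsEmbedding) :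
    i.IsEmbedding := by
  obtain ⟨⟨hE, hV, hP⟩, hfull⟩ := h
  refine ⟨⟨Function.Injective.of_comp (f := u.edgeMap) hE,
    Function.Injective.of_comp (f := u.vMap) hV,
    Function.Injective.of_comp (f := u.epMap) hP⟩, fun v x hx => ?_⟩
  obtain ⟨x₀, hx₀⟩ := hfull v (u.edgeMap x) (by
    rw [u.s_comm, u.t_comm]
    exact hx.imp (fun h => by rw [h]; rfl) (fun h => by rw [h]; rfl))
  have hinj : Function.LeftInverse w.edgeMap u.edgeMap :=
    fun y => congrFun (congrArg POGHom.edgeMap hw) y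
  exact ⟨x₀, hinj.injective hx₀⟩

/-- The first leg of a plugging is an open embedding. -/
theorem IsPluggingAt.isEmbedding {K G₁ G₂ M : POG} {b : POGHom K G₁} {d : POGHom K G₂}
    {i : POGHom G₁ M} {j : POGHom G₂ M} (h : IsPluggingAt b d i j) : i.IsEmbedding := by
  have hopen := h.glue_isOpen
  obtain ⟨⟨-, -, -, -, hde, -, hM, hij, huniv⟩, hK, -⟩ := h
  obtain ⟨u, ⟨hul, hur⟩, -⟩ := huniv _ hopen _ _ (comp_glueLeft_eq_comp_glueRight hK b hde.1.2.2)
  refine POGHom.IsEmbedding.of_comp (u := u) (w := glueDesc hij) ?_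
    (hul ▸ glueLeft_isEmbedding b d)
  refine (huniv M hM i j hij).unique ⟨?_, ?_⟩ ⟨rfl, rfl⟩
  · change (glueDesc hij).comp (u.comp i) = i
    rw [hul]
    rfl
  · change (glueDesc hij).comp (u.comp j) = j
    rw [hur]
    exact POGHom.ext_maps (fun _ => rfl) (fun _ => rfl) (elim_gluePt hij)

/-- Soundness of sequential merging: if the sequential merging
`(r₁ ;_p r₂) : G → G'` is a rewrite — where `M = R₁ ⊕_p L₂` with induced maps
`m, m'`, `G = M[R₁ ↦ L₁]_m` and `G' = M[L₂ ↦ R₂]_{m'}` — then there exist a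
graph `H` and matches such that `G` rewrites to `H` by the extension of `r₁`
and `H` rewrites to `G'` by the extension of `r₂`. -/
theorem sequential_merging_sound
    {L₁ R₁ L₂ R₂ K M G G' : POG}
    (hr₁ : IsRewrite L₁ R₁) (hr₂ : IsRewrite L₂ R₂)
    (e : POGHom K R₁) (e' : POGHom K L₂) (m : POGHom R₁ M) (m' : POGHom L₂ M)
    (hmerge : IsMergingAt e e' m m')
    (hG : IsSubstitutionAt M m L₁ G)
    (hG' : IsSubstitutionAt M m' R₂ G') :
    ∃ H : POG, RewriteStep L₁ R₁ G H ∧ RewriteStep L₂ R₂ H G' := by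
  obtain ⟨D, P, b, d, b', iD, iL, iD', hM, hL⟩ := hG
  obtain ⟨D₂, P₂, b₂, d₂, b₂', iD₂, iR, iD₂', hM₂, hR⟩ := hG'
  exact ⟨M,
    ⟨G, Homeo.refl G, iL, hL.isEmbedding, D, P, b', d, b, iD', m, iD, hL, hM⟩,
    ⟨M, Homeo.refl M, m', hM₂.isEmbedding, D₂, P₂, b₂, d₂, b₂', iD₂, iR, iD₂', hM₂, hR⟩⟩
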